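/- Let ε ∈ (0,1), M ≥ 1, W ≥ 1, D ≥ 1. Let σ : ℝ → ℝ be 1-Lipschitz, and let p : ℝ → ℝ be a polynomial such that |σ(t) − p(t)| ≤ ε/(W^D · D) for all t ∈ [−2M, 2M]. Let N be a feedforward network with D hidden layers, activation σ, and weights satisfying: ‖w_j^(0)‖₂ ≤ M for every first-layer unit j; ‖w_j^(i)‖₁ ≤ W for every unit j and every layer index i ∈ {1,…,D}; and h_j^(l)(x) ∈ [−M, M] for every x ∈ S^{n−1}, every l ∈ {0,…,D−1}, and every unit j. Let N̄ be the network with the identical architecture and identical weights but with the activation σ replaced by p at every hidden unit. Then sup_{x ∈ S^{n−1}} |N(x) − N̄(x)| ≤ ε. -/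

import Mathlib

open Finset

/-- Pre-activation values of a fully-connected feedforward network with
activation `σ`, layer widths `width`, and weights `w` (where `w i j k` is the
weight of the edge from unit `k` of layer `i` to unit `j` of layer `i+1`):
`preact σ width w i j x = h_j^(i)(x)`, the input of unit `j` in layer `i+1`. -/
noncomputable def preact (σ : ℝ → ℝ) (width : ℕ → ℕ)
    (w : (i : ℕ) → Fin (width (i + 1)) → Fin (width i) → ℝ) :
    (i : ℕ) → Fin (width (i + 1)) → (Fin (width 0) → ℝ) → ℝ
  | 0, j, x => ∑ k, w 0 j k * x k
  | (i + 1), j, x => ∑ k, w (i + 1) j k * σ (preact σ width w i k x)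

/-- Approximate polynomial networks: if `σ` is 1-Lipschitz, `p` is a polynomial
with `|σ(t) − p(t)| ≤ ε/(W^D·D)` on `[−2M, 2M]`, and the network `N` with `D`
hidden layers has first-layer weight vectors of `ℓ₂`-norm at most `M`, higher
layer weight vectors of `ℓ₁`-norm at most `W`, and all hidden pre-activations
in `[−M, M]` on the unit sphere, then replacing `σ` by `p` everywhere changes
the output by at most `ε` on the unit sphere. -/
theorem approx_poly_network (ε M W : ℝ) (D : ℕ)
    (hε : ε ∈ Set.Ioo (0 : ℝ) 1) (hM : 1 ≤ M) (hW : 1 ≤ W) (hD : 1 ≤ D)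
    (σ : ℝ → ℝ) (hσ : LipschitzWith 1 σ)
    (P : Polynomial ℝ)
    (happrox : ∀ t ∈ Set.Icc (-(2 * M)) (2 * M),
      |σ t - P.eval t| ≤ ε / (W ^ D * (D : ℝ)))
    (width : ℕ → ℕ)
    (w : (i : ℕ) → Fin (width (i + 1)) → Fin (width i) → ℝ)
    (hw0 : ∀ j : Fin (width 1), Real.sqrt (∑ k, (w 0 j k) ^ 2) ≤ M)
    (hwi : ∀ i : ℕ, 1 ≤ i → i ≤ D → ∀ j : Fin (width (i + 1)), (∑ k, |w i j k|) ≤ W)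
    (hpre : ∀ l : ℕ, l < D → ∀ j : Fin (width (l + 1)),
      ∀ x : Fin (width 0) → ℝ, (∑ k, (x k) ^ 2) = 1 →
        preact σ width w l j x ∈ Set.Icc (-M) M) :
    ∀ x : Fin (width 0) → ℝ, (∑ k, (x k) ^ 2) = 1 →
      ∀ j : Fin (width (D + 1)),
        |preact σ width w D j x - preact (fun t => P.eval t) width w D j x| ≤ ε := by
  intro x hx
  obtain ⟨hε0, hε1⟩ := hε
  have hDp : (0 : ℝ) < D := by exact_mod_cast hD
  have hW0 : (0 : ℝ) < W := by linarith
  set δ := ε / (W ^ D * (D : ℝ)) with hδ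
  have hδ0 : 0 < δ := by positivity
  have hδe : (D : ℝ) * W ^ D * δ = ε := by
    rw [hδ]; field_simp
  have hbound : ∀ i : ℕ, i ≤ D → (i : ℝ) * W ^ i * δ ≤ ε := by
    intro i hi
    rw [← hδe]
    have h1 : (i : ℝ) ≤ D := by exact_mod_cast hi
    have h2 : W ^ i ≤ W ^ D := pow_le_pow_right₀ hW hi
    gcongr
  have key : ∀ i : ℕ, i ≤ D → ∀ j : Fin (width (i + 1)),
      |preact σ width w i j x - preact (fun t => P.eval t) width w i j x|
        ≤ (i : ℝ) * W ^ i * δ := by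
    intro i
    induction i with
    | zero => intro _ j; simp [preact]
    | succ i ih =>
      intro hi j
      have hk : ∀ k, |σ (preact σ width w i k x)
          - P.eval (preact (fun t => P.eval t) width w i k x)| ≤ (i : ℝ) * W ^ i * δ + δ := by
        intro k
        have h1 := ih (by omega) k
        have h2 := hbound i (by omega)
        obtain ⟨h3, h4⟩ := hpre i (by omega) k x hx
        generalize preact σ width w i k x = a at *
        generalize preact (fun t => P.eval t) width w i k x = b at *
        have h5 := abs_le.mp h1
        have h6 := happrox b ⟨by linarith [h5.1, h5.2], by linarith [h5.1, h5.2]⟩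
        have h7 : |σ a - σ b| ≤ |a - b| := by
          have := hσ.dist_le_mul a b
          simpa [Real.dist_eq] using this
        have h8 := abs_sub_le (σ a) (σ b) (P.eval b)
        linarith
      have hB : 0 ≤ (i : ℝ) * W ^ i * δ + δ := by positivity
      have hWi : 1 ≤ W ^ i := one_le_pow₀ hW
      simp only [preact]
      rw [← Finset.sum_sub_distrib]
      calc _ ≤ ∑ k, |w (i + 1) j k| * ((i : ℝ) * W ^ i * δ + δ) := by
            refine (Finset.abs_sum_le_sum_abs _ _).trans (Finset.sum_le_sum fun k _ => ?_)
            rw [← mul_sub, abs_mul]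
            exact mul_le_mul_of_nonneg_left (hk k) (abs_nonneg _)
        _ = (∑ k, |w (i + 1) j k|) * ((i : ℝ) * W ^ i * δ + δ) := by rw [Finset.sum_mul]
        _ ≤ W * ((i : ℝ) * W ^ i * δ + δ) :=
            mul_le_mul_of_nonneg_right (hwi (i + 1) (by omega) hi j) hB
        _ ≤ W * ((i : ℝ) * W ^ i * δ + W ^ i * δ) := by
            have : δ ≤ W ^ i * δ := le_mul_of_one_le_left hδ0.le hWi
            gcongr
        _ = _ := by push_cast; ring
  intro j
  exact (key D le_rfl j).trans (hbound D le_rfl)
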